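/- Let R > 0, λ, Λ > 0 and let g = (g_ij) be a Lipschitz map from B_R to symmetric positive-definite n×n matrices with g_ij(0) = δ_ij, R·(Lipschitz seminorm of each g_ij on B_R) ≤ Λ, and λ|ξ|² ≤ g_ij(x)ξ^iξ^j ≤ λ⁻¹|ξ|² for all x ∈ B_R and ξ ∈ ℝⁿ. There exists ε₀ > 0 depending only on n, λ, Λ and R such that for all 0 < ε < ε₀, all constants F, A > 0, and every v ∈ C²(B_R) ∩ C(closure of B_R) satisfying −ε² Δ_g v(x) + 2 v(x) ≤ F for almost every x ∈ B_R and v ≤ A on ∂B_R, one has v(x) ≤ F/2 + A·exp( √λ (|x|² − R²) / (2εR) ) for all x ∈ B_R. Here Δ_g v = (det g)^{−1/2} ∂_i( (det g)^{1/2} g^{ij} ∂_j v ), which is defined almost everywhere since g is Lipschitz and v is C². -/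

import Mathlib

open MeasureTheory Metric

noncomputable section

/-- `n`-dimensional Euclidean space. -/
abbrev Euc (n : ℕ) : Type := EuclideanSpace ℝ (Fin n)

/-- The Laplace–Beltrami operator
`Δ_g v = (det g)^{−1/2} ∂_i( (det g)^{1/2} g^{ij} ∂_j v )`, defined pointwise via `fderiv`
(hence defined almost everywhere when `g` is Lipschitz and `v` is `C²`). -/
def laplacianG {n : ℕ} (g : Euc n → Matrix (Fin n) (Fin n) ℝ) (v : Euc n → ℝ)
    (x : Euc n) : ℝ :=
  (Real.sqrt (g x).det)⁻¹ *
    ∑ i, fderiv ℝ (fun y => Real.sqrt (g y).det *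
        ∑ j, (g y)⁻¹ i j * fderiv ℝ v y (EuclideanSpace.single j 1))
      x (EuclideanSpace.single i 1)

open Topology

theorem contDiffAt_matrix_det {E ι : Type*} [NormedAddCommGroup E] [NormedSpace ℝ E]
    [Fintype ι] [DecidableEq ι] {k : WithTop ℕ∞} {M : E → Matrix ι ι ℝ} {x : E}
    (hM : ∀ i j, ContDiffAt ℝ k (fun y => M y i j) x) :
    ContDiffAt ℝ k (fun y => (M y).det) x := by
  simp only [Matrix.det_apply']
  exact ContDiffAt.sum fun σ _ => contDiffAt_const.mul (contDiffAt_prod fun i _ => hM _ _)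

theorem contDiffAt_matrix_inv_apply {E ι : Type*} [NormedAddCommGroup E] [NormedSpace ℝ E]
    [Fintype ι] [DecidableEq ι] {k : WithTop ℕ∞} {M : E → Matrix ι ι ℝ} {x : E}
    (hM : ∀ i j, ContDiffAt ℝ k (fun y => M y i j) x) (hdet : (M x).det ≠ 0) (i j : ι) :
    ContDiffAt ℝ k (fun y => (M y)⁻¹ i j) x := by
  simp only [Matrix.inv_def, Ring.inverse_eq_inv', Matrix.smul_apply, smul_eq_mul,
    Matrix.adjugate_apply]
  refine ((contDiffAt_matrix_det hM).inv hdet).mul (contDiffAt_matrix_det fun a b => ?_)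
  by_cases h : a = j
  · simpa [Matrix.updateRow_apply, h] using contDiffAt_const
  · simpa [Matrix.updateRow_apply, h] using hM a b

/-- The entries of `√(det m) m⁻¹`, as functions of the entries of `m`. -/
def sqrtDetInv {n : ℕ} (i j : Fin n) (m : Fin n → Fin n → ℝ) : ℝ :=
  Real.sqrt (Matrix.of m).det * (Matrix.of m)⁻¹ i j

theorem contDiffAt_entry {n : ℕ} {k : WithTop ℕ∞} (m : Fin n → Fin n → ℝ) (i j : Fin n) :
    ContDiffAt ℝ k (fun m : Fin n → Fin n → ℝ => (Matrix.of m) i j) m := by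
  change ContDiffAt ℝ k (fun m : Fin n → Fin n → ℝ => m i j) m
  fun_prop

theorem contDiffAt_sqrtDetInv {n : ℕ} (i j : Fin n) {m : Fin n → Fin n → ℝ}
    (hm : (Matrix.of m).det ≠ 0) {k : WithTop ℕ∞} : ContDiffAt ℝ k (sqrtDetInv i j) m :=
  ((contDiffAt_matrix_det (contDiffAt_entry m)).sqrt hm).mul
    (contDiffAt_matrix_inv_apply (contDiffAt_entry m) hm i j)

/-- A twice continuously differentiable function has nonpositive Hessian at a local maximum. -/
theorem IsLocalMax.fderiv_fderiv_nonpos {E : Type*} [NormedAddCommGroup E] [NormedSpace ℝ E]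
    {u : E → ℝ} {x : E} (hmax : IsLocalMax u x) (hu : ContDiffAt ℝ 2 u x) (w : E) :
    fderiv ℝ (fderiv ℝ u) x w w ≤ 0 := by
  by_contra! hpos
  have hline (t : ℝ) : HasDerivAt (fun s : ℝ => x + s • w) w t := by
    simpa using ((hasDerivAt_id t).smul_const w).const_add x
  have hcont : Filter.Tendsto (fun s : ℝ => x + s • w) (𝓝 0) (𝓝 x) := by
    simpa using (hline 0).continuousAt.tendsto
  have hdiff : ∀ᶠ y in 𝓝 x, DifferentiableAt ℝ u y :=
    (hu.eventually (by simp)).mono fun y hy => hy.differentiableAt (by simp)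
  have hderiv : ∀ᶠ t in 𝓝 (0 : ℝ),
      deriv (fun s : ℝ => u (x + s • w)) t = fderiv ℝ u (x + t • w) w :=
    (hcont.eventually hdiff).mono fun t ht =>
      (ht.hasFDerivAt.comp_hasDerivAt t (hline t)).deriv
  have hfd : DifferentiableAt ℝ (fderiv ℝ u) x :=
    (hu.fderiv_right (m := 1) (by norm_num)).differentiableAt (by simp)
  have hsecond : deriv (deriv (fun s : ℝ => u (x + s • w))) 0 =
      fderiv ℝ (fderiv ℝ u) x w w := by
    rw [Filter.EventuallyEq.deriv_eq hderiv]
    have h0 : HasFDerivAt (fderiv ℝ u) (fderiv ℝ (fderiv ℝ u) x) (x + (0 : ℝ) • w) := by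
      simpa using hfd.hasFDerivAt
    have h1 := h0.comp_hasDerivAt (0 : ℝ) (hline 0)
    exact (((ContinuousLinearMap.apply ℝ ℝ w).hasFDerivAt).comp_hasDerivAt (0 : ℝ) h1).deriv
  have hmax' : IsLocalMax (fun s : ℝ => u (x + s • w)) 0 :=
    (hcont.eventually hmax).mono fun t ht => by simpa using ht
  have hc : ContinuousAt (fun s : ℝ => u (x + s • w)) 0 := by
    refine ContinuousAt.comp (g := u) ?_ (hline 0).continuousAt
    simpa using hu.continuousAt
  have hmin := isLocalMin_of_deriv_deriv_pos (hsecond ▸ hpos) hmax'.deriv_eq_zero hc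
  have hconst : (fun s : ℝ => u (x + s • w)) =ᶠ[𝓝 0] fun _ => u (x + (0 : ℝ) • w) := by
    filter_upwards [hmax', hmin] with t h1 h2 using le_antisymm h1 h2
  have : deriv (deriv (fun s : ℝ => u (x + s • w))) 0 = 0 := by
    rw [hconst.deriv.deriv_eq]; simp
  linarith

theorem Matrix.PosSemidef.sum_mul_bilin_nonpos {E ι : Type*} [NormedAddCommGroup E]
    [NormedSpace ℝ E] [Fintype ι] [DecidableEq ι] {M : Matrix ι ι ℝ} (hM : M.PosSemidef)
    (H : E →L[ℝ] E →L[ℝ] ℝ) (hH : ∀ w, H w w ≤ 0) (e : ι → E) :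
    ∑ i, ∑ j, M i j * H (e i) (e j) ≤ 0 := by
  obtain ⟨B, rfl⟩ : ∃ B : Matrix ι ι ℝ, M = B.conjTranspose * B := by
    open scoped MatrixOrder in
    exact CStarAlgebra.nonneg_iff_eq_star_mul_self.mp hM.nonneg
  have : ∑ i, ∑ j, (B.conjTranspose * B) i j * H (e i) (e j) =
      ∑ k, H (∑ i, B k i • e i) (∑ j, B k j • e j) := by
    simp only [Matrix.mul_apply, Matrix.conjTranspose_apply, star_trivial, map_sum, map_smul,
      _root_.sum_apply, _root_.smul_apply, smul_eq_mul,
      Finset.sum_mul, Finset.mul_sum]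
    rw [Finset.sum_congr rfl fun i _ => Finset.sum_comm, Finset.sum_comm]
    refine Finset.sum_congr rfl fun k _ => ?_
    rw [Finset.sum_comm]
    exact Finset.sum_congr rfl fun i _ => Finset.sum_congr rfl fun j _ => by ring
  rw [this]
  exact Finset.sum_nonpos fun k _ => hH _

theorem sum_inv_mul_mul_le {ι : Type*} [Fintype ι] [DecidableEq ι] {M : Matrix ι ι ℝ} {c : ℝ}
    (hc : 0 < c) (hdet : M.det ≠ 0)
    (hM : ∀ ξ : ι → ℝ, c * ∑ i, ξ i ^ 2 ≤ ∑ i, ∑ j, M i j * ξ i * ξ j) (x : ι → ℝ) :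
    ∑ i, ∑ j, M⁻¹ i j * (x i * x j) ≤ c⁻¹ * ∑ i, x i ^ 2 := by
  set ξ := M⁻¹.mulVec x with hξ
  have hMξ : M.mulVec ξ = x := by
    rw [hξ, Matrix.mulVec_mulVec, Matrix.mul_nonsing_inv _ (Ne.isUnit hdet), Matrix.one_mulVec]
  have h1 : ∑ i, ∑ j, M⁻¹ i j * (x i * x j) = ∑ i, x i * ξ i := by
    simp only [hξ, Matrix.mulVec, dotProduct, Finset.mul_sum]
    exact Finset.sum_congr rfl fun i _ => Finset.sum_congr rfl fun j _ => by ring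
  have h2 : ∑ i, ∑ j, M i j * ξ i * ξ j = ∑ i, x i * ξ i := by
    refine Finset.sum_congr rfl fun i _ => ?_
    rw [← congrFun hMξ i]
    simp only [Matrix.mulVec, dotProduct, Finset.sum_mul]
    exact Finset.sum_congr rfl fun j _ => by ring
  have h3 := hM ξ
  have h4 : 0 ≤ ∑ i, (x i - c * ξ i) ^ 2 := Finset.sum_nonneg fun i _ => sq_nonneg _
  have h5 : ∑ i, (x i - c * ξ i) ^ 2 =
      ∑ i, x i ^ 2 - 2 * c * ∑ i, x i * ξ i + c ^ 2 * ∑ i, ξ i ^ 2 := by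
    simp only [Finset.mul_sum, ← Finset.sum_sub_distrib, ← Finset.sum_add_distrib]
    exact Finset.sum_congr rfl fun i _ => by ring
  rw [h1, inv_mul_eq_div, le_div_iff₀ hc]
  nlinarith [mul_le_mul_of_nonneg_left h3 hc.le]

/-- Matrices with entries bounded by `r`, nonnegative determinant and quadratic form bounded
below by `c`. -/
def coerciveSet (n : ℕ) (c r : ℝ) : Set (Fin n → Fin n → ℝ) :=
  closedBall 0 r ∩ {m | 0 ≤ (Matrix.of m).det} ∩
    {m | ∀ ξ : Fin n → ℝ, c * ∑ i, ξ i ^ 2 ≤ ∑ i, ∑ j, m i j * ξ i * ξ j}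

theorem isCompact_coerciveSet (n : ℕ) (c r : ℝ) : IsCompact (coerciveSet n c r) := by
  have hdet : Continuous fun m : Fin n → Fin n → ℝ => (Matrix.of m).det :=
    continuous_iff_continuousAt.mpr fun m =>
      (contDiffAt_matrix_det (contDiffAt_entry (k := 0) m)).continuousAt
  refine ((isCompact_closedBall _ _).inter_right
    (isClosed_le continuous_const hdet)).inter_right ?_
  rw [Set.ofPred_forall]
  exact isClosed_iInter fun ξ => isClosed_le continuous_const (by fun_prop)

theorem det_ne_zero_of_coercive {ι : Type*} [Fintype ι] [DecidableEq ι] {M : Matrix ι ι ℝ}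
    {c : ℝ} (hc : 0 < c)
    (hM : ∀ ξ : ι → ℝ, c * ∑ i, ξ i ^ 2 ≤ ∑ i, ∑ j, M i j * ξ i * ξ j) : M.det ≠ 0 := by
  intro h0
  obtain ⟨ξ, hξ, hMξ⟩ := Matrix.exists_mulVec_eq_zero_iff.mpr h0
  have h1 : ∑ i, ∑ j, M i j * ξ i * ξ j = 0 := by
    refine Finset.sum_eq_zero fun i _ => ?_
    have := congrFun hMξ i
    simp only [Matrix.mulVec, dotProduct, Pi.zero_apply] at this
    calc ∑ j, M i j * ξ i * ξ j = ξ i * ∑ j, M i j * ξ j := by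
          rw [Finset.mul_sum]; exact Finset.sum_congr rfl fun j _ => by ring
      _ = 0 := by rw [this, mul_zero]
  have h2 := hM ξ
  rw [h1] at h2
  have h3 : ∑ i, ξ i ^ 2 = 0 :=
    le_antisymm (nonpos_of_mul_nonpos_right h2 hc) (Finset.sum_nonneg fun i _ => sq_nonneg _)
  rw [Finset.sum_eq_zero_iff_of_nonneg fun i _ => sq_nonneg _] at h3
  exact hξ (funext fun i => by simpa using h3 i (Finset.mem_univ i))

theorem exists_coefficient_bounds (n : ℕ) {c r : ℝ} (hc : 0 < c) :
    ∃ C, 0 ≤ C ∧ ∀ m ∈ coerciveSet n c r,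
      (Real.sqrt (Matrix.of m).det)⁻¹ ≤ C ∧ ∑ i, (Matrix.of m)⁻¹ i i ≤ C ∧
      ∀ i j, ‖fderiv ℝ (sqrtDetInv i j) m‖ ≤ C := by
  let f (m : Fin n → Fin n → ℝ) : ℝ := (Real.sqrt (Matrix.of m).det)⁻¹ +
    |∑ i, (Matrix.of m)⁻¹ i i| + ∑ i, ∑ j, ‖fderiv ℝ (sqrtDetInv i j) m‖
  have hcont : ContinuousOn f (coerciveSet n c r) := by
    intro m hm
    have hdet : (Matrix.of m).det ≠ 0 := det_ne_zero_of_coercive hc hm.2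
    have hdet0 : Real.sqrt (Matrix.of m).det ≠ 0 :=
      (Real.sqrt_pos.mpr (lt_of_le_of_ne hm.1.2 hdet.symm)).ne'
    refine ContinuousAt.continuousWithinAt ?_
    have hsqrt : ContinuousAt (fun m : Fin n → Fin n → ℝ => Real.sqrt (Matrix.of m).det) m :=
      ((contDiffAt_matrix_det (contDiffAt_entry (k := 0) m)).sqrt hdet).continuousAt
    refine ((hsqrt.inv₀ hdet0).add (ContinuousAt.abs ?_)).add ?_
    · exact tendsto_finsetSum _ fun i _ =>
        (contDiffAt_matrix_inv_apply (contDiffAt_entry (k := 0) m) hdet i i).continuousAt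
    · refine tendsto_finsetSum _ fun i _ => tendsto_finsetSum _ fun j _ => ?_
      exact ((contDiffAt_sqrtDetInv i j hdet (k := 1)).fderiv_right (m := 0)
        (by norm_num)).continuousAt.norm
  obtain ⟨C, hC⟩ := (isCompact_coerciveSet n c r).exists_bound_of_continuousOn hcont
  refine ⟨|C|, abs_nonneg _, fun m hm => ?_⟩
  have h := (le_abs_self _).trans ((hC m hm).trans (le_abs_self C))
  have h1 : 0 ≤ (Real.sqrt (Matrix.of m).det)⁻¹ := by positivity
  have h2 := abs_nonneg (∑ i, (Matrix.of m)⁻¹ i i)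
  have h3 : 0 ≤ ∑ i, ∑ j, ‖fderiv ℝ (sqrtDetInv i j) m‖ := by positivity
  refine ⟨by linarith, by linarith [le_abs_self (∑ i, (Matrix.of m)⁻¹ i i)], fun i j => ?_⟩
  have h4 : ‖fderiv ℝ (sqrtDetInv i j) m‖ ≤ ∑ i, ∑ j, ‖fderiv ℝ (sqrtDetInv i j) m‖ :=
    (Finset.single_le_sum (f := fun j => ‖fderiv ℝ (sqrtDetInv i j) m‖)
      (fun _ _ => norm_nonneg _) (Finset.mem_univ j)).trans
    (Finset.single_le_sum (f := fun i => ∑ j, ‖fderiv ℝ (sqrtDetInv i j) m‖)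
      (fun _ _ => by positivity) (Finset.mem_univ i))
  linarith

theorem laplacianG_eq {n : ℕ} {g : Euc n → Matrix (Fin n) (Fin n) ℝ} {v : Euc n → ℝ}
    {x : Euc n} {G : Euc n → Fin n → Fin n → ℝ} (hG : ∀ y, Matrix.of (G y) = g y)
    (hGd : DifferentiableAt ℝ G x) (hdet : 0 < (g x).det)
    (hv : DifferentiableAt ℝ (fderiv ℝ v) x) :
    laplacianG g v x =
      ∑ j, ((Real.sqrt (g x).det)⁻¹ * ∑ i, fderiv ℝ (sqrtDetInv i j) (G x)
        (fderiv ℝ G x (EuclideanSpace.single i 1))) * fderiv ℝ v x (EuclideanSpace.single j 1) +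
      ∑ i, ∑ j, (g x)⁻¹ i j * fderiv ℝ (fderiv ℝ v) x (EuclideanSpace.single i 1)
        (EuclideanSpace.single j 1) := by
  have hs : Real.sqrt (g x).det ≠ 0 := (Real.sqrt_pos.mpr hdet).ne'
  have hterm (i : Fin n) : fderiv ℝ (fun y => Real.sqrt (g y).det *
        ∑ j, (g y)⁻¹ i j * fderiv ℝ v y (EuclideanSpace.single j 1))
      x (EuclideanSpace.single i 1) =
      ∑ j, (fderiv ℝ (sqrtDetInv i j) (G x) (fderiv ℝ G x (EuclideanSpace.single i 1)) *
          fderiv ℝ v x (EuclideanSpace.single j 1) +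
        Real.sqrt (g x).det * (g x)⁻¹ i j * fderiv ℝ (fderiv ℝ v) x (EuclideanSpace.single i 1)
          (EuclideanSpace.single j 1)) := by
    have hfun : (fun y => Real.sqrt (g y).det *
        ∑ j, (g y)⁻¹ i j * fderiv ℝ v y (EuclideanSpace.single j 1)) =
        fun y => ∑ j, sqrtDetInv i j (G y) * fderiv ℝ v y (EuclideanSpace.single j 1) := by
      funext y
      simp only [sqrtDetInv, hG, Finset.mul_sum, mul_assoc]
    have hΨ (j : Fin n) : HasFDerivAt (fun y => sqrtDetInv i j (G y))
        ((fderiv ℝ (sqrtDetInv i j) (G x)).comp (fderiv ℝ G x)) x :=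
      ((contDiffAt_sqrtDetInv i j (k := 1) (by rw [hG]; exact hdet.ne')).differentiableAt
        (by simp)).hasFDerivAt.comp x hGd.hasFDerivAt
    have hD (j : Fin n) : HasFDerivAt (fun y => fderiv ℝ v y (EuclideanSpace.single j 1))
        ((ContinuousLinearMap.apply ℝ ℝ (EuclideanSpace.single j (1 : ℝ))).comp
          (fderiv ℝ (fderiv ℝ v) x)) x :=
      ((ContinuousLinearMap.apply ℝ ℝ (EuclideanSpace.single j (1 : ℝ))).hasFDerivAt).comp x
        hv.hasFDerivAt
    rw [hfun, (HasFDerivAt.fun_sum fun j (_ : j ∈ Finset.univ) => (hΨ j).fun_mul (hD j)).fderiv]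
    simp only [_root_.sum_apply, _root_.add_apply, _root_.smul_apply, smul_eq_mul,
      ContinuousLinearMap.comp_apply, ContinuousLinearMap.apply_apply]
    refine Finset.sum_congr rfl fun j _ => ?_
    simp only [sqrtDetInv, hG]
    ring
  simp only [laplacianG, hterm, Finset.sum_add_distrib, mul_add]
  congr 1
  · rw [Finset.sum_comm, Finset.mul_sum]
    refine Finset.sum_congr rfl fun j _ => ?_
    rw [mul_assoc, Finset.sum_mul]
  · simp only [Finset.mul_sum]
    refine Finset.sum_congr rfl fun i _ => Finset.sum_congr rfl fun j _ => ?_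
    field_simp

theorem laplacianG_le {n : ℕ} {g : Euc n → Matrix (Fin n) (Fin n) ℝ} {v : Euc n → ℝ}
    {x : Euc n} {G : Euc n → Fin n → Fin n → ℝ} (hG : ∀ y, Matrix.of (G y) = g y)
    (hGd : DifferentiableAt ℝ G x) (hdet : 0 < (g x).det)
    (hv : DifferentiableAt ℝ (fderiv ℝ v) x) {C L : ℝ} (hC : 0 ≤ C)
    (hGL : ‖fderiv ℝ G x‖ ≤ L) (hsC : (Real.sqrt (g x).det)⁻¹ ≤ C)
    (hΨC : ∀ i j, ‖fderiv ℝ (sqrtDetInv i j) (G x)‖ ≤ C) :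
    laplacianG g v x ≤
      C * (n * (C * L)) * ∑ j, |fderiv ℝ v x (EuclideanSpace.single j 1)| +
      ∑ i, ∑ j, (g x)⁻¹ i j * fderiv ℝ (fderiv ℝ v) x (EuclideanSpace.single i 1)
        (EuclideanSpace.single j 1) := by
  rw [laplacianG_eq hG hGd hdet hv, Finset.mul_sum]
  refine add_le_add (Finset.sum_le_sum fun j _ => ?_) le_rfl
  refine (le_abs_self _).trans ?_
  rw [abs_mul, abs_mul, abs_of_nonneg (a := (Real.sqrt (g x).det)⁻¹) (by positivity)]
  gcongr
  refine (Finset.abs_sum_le_sum_abs _ _).trans ?_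
  refine (Finset.sum_le_card_nsmul _ _ (C * L) fun i _ => ?_).trans (by simp)
  rw [← Real.norm_eq_abs]
  refine (ContinuousLinearMap.le_opNorm _ _).trans ?_
  refine mul_le_mul (hΨC i j) ?_ (norm_nonneg _) hC
  exact ((fderiv ℝ G x).le_opNorm _).trans (by simpa using hGL)

theorem hasFDerivAt_expBarrier {n : ℕ} (A κ r : ℝ) (x : Euc n) :
    HasFDerivAt (fun y : Euc n => A * Real.exp (κ * (‖y‖ ^ 2 - r)))
      ((A * Real.exp (κ * (‖x‖ ^ 2 - r)) * (2 * κ)) • innerSL ℝ x) x := by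
  have h := ((((hasStrictFDerivAt_norm_sq x).hasFDerivAt.sub_const r).const_mul κ).exp).const_mul
    A
  refine h.congr_fderiv ?_
  ext w
  simp
  ring

theorem fderiv_expBarrier {n : ℕ} (A κ r : ℝ) :
    fderiv ℝ (fun y : Euc n => A * Real.exp (κ * (‖y‖ ^ 2 - r))) =
      fun x => (A * Real.exp (κ * (‖x‖ ^ 2 - r)) * (2 * κ)) • innerSL ℝ x :=
  funext fun x => (hasFDerivAt_expBarrier A κ r x).fderiv

theorem fderiv_fderiv_expBarrier {n : ℕ} (A κ r : ℝ) (x w w' : Euc n) :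
    fderiv ℝ (fderiv ℝ (fun y : Euc n => A * Real.exp (κ * (‖y‖ ^ 2 - r)))) x w w' =
      A * Real.exp (κ * (‖x‖ ^ 2 - r)) *
        (4 * κ ^ 2 * (inner ℝ x w * inner ℝ x w') + 2 * κ * inner ℝ w w') := by
  rw [fderiv_expBarrier]
  have h := ((hasFDerivAt_expBarrier A κ r x).mul_const (2 * κ)).fun_smul
    ((innerSL ℝ (E := Euc n)).hasFDerivAt (x := x))
  have hinner (a b : Euc n) : innerSL ℝ a b = inner ℝ a b := rfl
  rw [HasFDerivAt.fderiv h]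
  simp [hinner]
  ring

theorem contDiff_expBarrier {n : ℕ} (A κ r : ℝ) {k : WithTop ℕ∞} :
    ContDiff ℝ k (fun y : Euc n => A * Real.exp (κ * (‖y‖ ^ 2 - r))) :=
  contDiff_const.mul (contDiff_const.mul ((contDiff_norm_sq ℝ).sub contDiff_const)).exp

theorem mem_coerciveSet_of_lipschitz {n : ℕ} {R lam Lam : ℝ} (hR : 0 < R) (hLam : 0 < Lam)
    {g : Euc n → Matrix (Fin n) (Fin n) ℝ} (hpos : ∀ x ∈ ball (0 : Euc n) R, (g x).PosDef)
    (h0 : g 0 = 1)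
    (hlip : ∀ i j : Fin n, LipschitzOnWith (Real.toNNReal (Lam / R)) (fun x => g x i j)
      (ball (0 : Euc n) R))
    (hell : ∀ x ∈ ball (0 : Euc n) R, ∀ ξ : Fin n → ℝ,
      lam * ∑ i, ξ i ^ 2 ≤ ∑ i, ∑ j, g x i j * ξ i * ξ j)
    {x : Euc n} (hx : x ∈ ball (0 : Euc n) R) :
    (fun i j => g x i j) ∈ coerciveSet n lam (Lam + 1) := by
  refine ⟨⟨?_, (hpos x hx).det_pos.le⟩, hell x hx⟩
  rw [mem_closedBall_zero_iff, pi_norm_le_iff_of_nonneg (by positivity)]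
  intro i
  rw [pi_norm_le_iff_of_nonneg (by positivity)]
  intro j
  have h1 := (hlip i j).norm_sub_le hx (mem_ball_self hR)
  rw [Real.coe_toNNReal _ (by positivity), sub_zero] at h1
  have h2 : Lam / R * ‖x‖ ≤ Lam := by
    rw [div_mul_eq_mul_div, div_le_iff₀ hR]
    exact mul_le_mul_of_nonneg_left (mem_ball_zero_iff.mp hx).le hLam.le
  have h3 : ‖g 0 i j‖ ≤ 1 := by
    rw [h0, Matrix.one_apply]; split_ifs <;> simp
  have h4 := norm_sub_norm_le (g x i j) (g 0 i j)
  linarith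

theorem le_zero_of_ae_le_zero {X : Type*} [TopologicalSpace X] [MeasurableSpace X]
    {μ : Measure X} [μ.IsOpenPosMeasure] {U : Set X} (hU : IsOpen U) {f : X → ℝ}
    (hf : ContinuousOn f U) (hae : ∀ᵐ x ∂μ, x ∈ U → f x ≤ 0) {x : X} (hx : x ∈ U) :
    f x ≤ 0 := by
  by_contra! hpos
  have hfreq : ∃ᶠ y in 𝓝 x, y ∈ U → f y ≤ 0 :=
    mem_closure_iff_frequently.mp (Measure.dense_of_ae hae x)
  have hev : ∀ᶠ y in 𝓝 x, y ∈ U ∧ 0 < f y :=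
    (hU.eventually_mem hx).and ((hf.continuousAt (hU.mem_nhds hx)).eventually (lt_mem_nhds hpos))
  obtain ⟨y, hy1, hy2, hy3⟩ := (hfreq.and_eventually hev).exists
  exact absurd (hy1 hy2) hy3.not_ge

theorem continuousAt_nondivergence_bound {n : ℕ} {g : Euc n → Matrix (Fin n) (Fin n) ℝ}
    {v : Euc n → ℝ} {x : Euc n} (hg : ∀ i j, ContinuousAt (fun y => g y i j) x)
    (hdet : (g x).det ≠ 0) (hv : ContDiffAt ℝ 2 v x) (K : ℝ) :
    ContinuousAt (fun y => K * ∑ j, |fderiv ℝ v y (EuclideanSpace.single j 1)| +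
      ∑ i, ∑ j, (g y)⁻¹ i j * fderiv ℝ (fderiv ℝ v) y (EuclideanSpace.single i 1)
        (EuclideanSpace.single j 1)) x := by
  have h1 : ContDiffAt ℝ 1 (fderiv ℝ v) x := hv.fderiv_right (by norm_num)
  have h2 : ContinuousAt (fderiv ℝ (fderiv ℝ v)) x :=
    (h1.fderiv_right (m := 0) (by norm_num)).continuousAt
  refine (continuousAt_const.mul (tendsto_finsetSum _ fun j _ => ?_)).add
    (tendsto_finsetSum _ fun i _ => tendsto_finsetSum _ fun j _ => ?_)
  · exact (h1.continuousAt.clm_apply continuousAt_const).abs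
  · refine ContinuousAt.mul ?_
      ((h2.clm_apply continuousAt_const).clm_apply continuousAt_const)
    have hg' : ContinuousAt (fun y => (fun i j => g y i j : Fin n → Fin n → ℝ)) x :=
      continuousAt_pi.mpr fun i => continuousAt_pi.mpr fun j => hg i j
    exact ContinuousAt.comp
      (g := fun m : Fin n → Fin n → ℝ => (Matrix.of m)⁻¹ i j)
      (contDiffAt_matrix_inv_apply (contDiffAt_entry (k := 0) _) hdet i j).continuousAt hg'

/-- A continuous nondivergence form of `−ε² Δ_g v + 2 v ≤ F`, valid everywhere in the ball. -/
theorem nondivergence_ineq {n : ℕ} {R L C ε F : ℝ} {K : Set (Fin n → Fin n → ℝ)} (hC : 0 ≤ C)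
    (hL : 0 ≤ L) (hbounds : ∀ m ∈ K, (Real.sqrt (Matrix.of m).det)⁻¹ ≤ C ∧
      ∀ i j, ‖fderiv ℝ (sqrtDetInv i j) m‖ ≤ C)
    {g : Euc n → Matrix (Fin n) (Fin n) ℝ} (hpos : ∀ x ∈ ball (0 : Euc n) R, (g x).PosDef)
    (hgK : ∀ x ∈ ball (0 : Euc n) R, (fun i j => g x i j) ∈ K)
    (hlip : ∀ i j : Fin n, LipschitzOnWith (Real.toNNReal L) (fun x => g x i j)
      (ball (0 : Euc n) R))
    {v : Euc n → ℝ} (hv : ContDiffOn ℝ 2 v (ball (0 : Euc n) R))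
    (hsub : ∀ᵐ x ∂(volume.restrict (ball (0 : Euc n) R)),
      -ε ^ 2 * laplacianG g v x + 2 * v x ≤ F)
    {x : Euc n} (hx : x ∈ ball (0 : Euc n) R) :
    2 * v x - F ≤ ε ^ 2 * (C * (n * (C * L)) *
        ∑ j, |fderiv ℝ v x (EuclideanSpace.single j 1)| +
      ∑ i, ∑ j, (g x)⁻¹ i j * fderiv ℝ (fderiv ℝ v) x (EuclideanSpace.single i 1)
        (EuclideanSpace.single j 1)) := by
  let G : Euc n → Fin n → Fin n → ℝ := fun y i j => g y i j
  have hGlip : LipschitzOnWith (Real.toNNReal L) G (ball (0 : Euc n) R) := by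
    refine LipschitzOnWith.of_dist_le_mul fun y hy z hz => ?_
    refine (dist_pi_le_iff (by positivity)).mpr fun i => ?_
    refine (dist_pi_le_iff (by positivity)).mpr fun j => ?_
    exact (hlip i j).dist_le_mul y hy z hz
  have hvat (y) (hy : y ∈ ball (0 : Euc n) R) : ContDiffAt ℝ 2 v y :=
    hv.contDiffAt (isOpen_ball.mem_nhds hy)
  have hcont : ContinuousOn (fun x => 2 * v x - F - ε ^ 2 * (C * (n * (C * L)) *
        ∑ j, |fderiv ℝ v x (EuclideanSpace.single j 1)| +
      ∑ i, ∑ j, (g x)⁻¹ i j * fderiv ℝ (fderiv ℝ v) x (EuclideanSpace.single i 1)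
        (EuclideanSpace.single j 1))) (ball (0 : Euc n) R) := by
    intro y hy
    refine ContinuousAt.continuousWithinAt ?_
    refine ((continuousAt_const.mul (hvat y hy).continuousAt).sub continuousAt_const).sub
      (continuousAt_const.mul (continuousAt_nondivergence_bound (fun i j => ?_)
        (hpos y hy).det_pos.ne' (hvat y hy) _))
    exact (hlip i j).continuousOn.continuousAt (isOpen_ball.mem_nhds hy)
  refine sub_nonpos.mp (le_zero_of_ae_le_zero (μ := volume) isOpen_ball hcont ?_ hx)
  have hdiff : ∀ᵐ y ∂(volume : Measure (Euc n)), y ∈ ball (0 : Euc n) R →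
      DifferentiableWithinAt ℝ G (ball (0 : Euc n) R) y :=
    hGlip.ae_differentiableWithinAt_of_mem
  filter_upwards [hdiff, (ae_restrict_iff' measurableSet_ball).mp hsub] with y hy1 hy2 hy
  have hle := laplacianG_le (g := g) (v := v) (G := G) (fun _ => rfl)
    ((hy1 hy).differentiableAt (isOpen_ball.mem_nhds hy)) (hpos y hy).det_pos
    (((hvat y hy).fderiv_right (m := 1) (by norm_num)).differentiableAt (by simp)) hC
    (L := L) (by
      simpa [hL] using norm_fderiv_le_of_lipschitzOn ℝ (isOpen_ball.mem_nhds hy) hGlip)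
    (hbounds _ (hgK y hy)).1 (hbounds _ (hgK y hy)).2
  nlinarith [hy2 hy, mul_le_mul_of_nonneg_left hle (sq_nonneg ε)]

theorem sum_abs_fderiv_expBarrier_le {n : ℕ} {A κ : ℝ} (hA : 0 ≤ A) (hκ : 0 ≤ κ) (r : ℝ)
    (x : Euc n) :
    ∑ j, |fderiv ℝ (fun y : Euc n => A * Real.exp (κ * (‖y‖ ^ 2 - r))) x
        (EuclideanSpace.single j 1)| ≤
      A * Real.exp (κ * (‖x‖ ^ 2 - r)) * (2 * κ * (n * ‖x‖)) := by
  refine (Finset.sum_le_card_nsmul _ _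
    (A * Real.exp (κ * (‖x‖ ^ 2 - r)) * (2 * κ) * ‖x‖) fun j _ => ?_).trans_eq ?_
  · rw [fderiv_expBarrier, _root_.smul_apply, smul_eq_mul, abs_mul, abs_of_nonneg (by positivity)]
    refine mul_le_mul_of_nonneg_left ?_ (by positivity)
    exact (abs_real_inner_le_norm x (EuclideanSpace.single j 1)).trans (by simp)
  · simp; ring

theorem sum_inv_mul_fderiv_fderiv_expBarrier {n : ℕ} (M : Matrix (Fin n) (Fin n) ℝ)
    (A κ r : ℝ) (x : Euc n) :
    ∑ i, ∑ j, M i j *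
        fderiv ℝ (fderiv ℝ (fun y : Euc n => A * Real.exp (κ * (‖y‖ ^ 2 - r)))) x
          (EuclideanSpace.single i 1) (EuclideanSpace.single j 1) =
      A * Real.exp (κ * (‖x‖ ^ 2 - r)) *
        (4 * κ ^ 2 * ∑ i, ∑ j, M i j * (x i * x j) + 2 * κ * ∑ i, M i i) := by
  have hsingle (i j : Fin n) : inner ℝ (EuclideanSpace.single i (1 : ℝ))
      (EuclideanSpace.single j (1 : ℝ)) = if i = j then (1 : ℝ) else 0 := by
    simp [EuclideanSpace.inner_single_left]
  have hdiag : ∑ i, M i i = ∑ i, ∑ j, M i j * if i = j then (1 : ℝ) else 0 := by simp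
  rw [hdiag]
  simp only [fderiv_fderiv_expBarrier, hsingle, EuclideanSpace.inner_single_right, mul_add,
    Finset.mul_sum, ← Finset.sum_add_distrib]
  refine Finset.sum_congr rfl fun i _ => Finset.sum_congr rfl fun j _ => ?_
  simp
  ring_nf

/-- Comparison principle: a supersolution dominating `v - F / 2` on the sphere also does so inside. -/
theorem le_barrier_of_nondivergence_ineq {n : ℕ} {R K F ε : ℝ}
    {g : Euc n → Matrix (Fin n) (Fin n) ℝ} (hpos : ∀ x ∈ ball (0 : Euc n) R, (g x).PosDef)
    {v φ : Euc n → ℝ} (hv : ContDiffOn ℝ 2 v (ball (0 : Euc n) R))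
    (hvc : ContinuousOn v (closedBall (0 : Euc n) R)) (hφ : ContDiff ℝ 2 φ)
    (hsub : ∀ x ∈ ball (0 : Euc n) R, 2 * v x - F ≤ ε ^ 2 * (K *
        ∑ j, |fderiv ℝ v x (EuclideanSpace.single j 1)| +
      ∑ i, ∑ j, (g x)⁻¹ i j * fderiv ℝ (fderiv ℝ v) x (EuclideanSpace.single i 1)
        (EuclideanSpace.single j 1)))
    (hsuper : ∀ x ∈ ball (0 : Euc n) R, ε ^ 2 * (K *
        ∑ j, |fderiv ℝ φ x (EuclideanSpace.single j 1)| +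
      ∑ i, ∑ j, (g x)⁻¹ i j * fderiv ℝ (fderiv ℝ φ) x (EuclideanSpace.single i 1)
        (EuclideanSpace.single j 1)) ≤ 2 * φ x)
    (hbdry : ∀ x ∈ sphere (0 : Euc n) R, v x ≤ F / 2 + φ x)
    {x : Euc n} (hx : x ∈ ball (0 : Euc n) R) : v x ≤ F / 2 + φ x := by
  by_contra! hlt
  obtain ⟨x₀, hx₀, hmax⟩ := (isCompact_closedBall (0 : Euc n) R).exists_isMaxOn
    ⟨x, ball_subset_closedBall hx⟩ (hvc.sub hφ.continuous.continuousOn)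
  have hgt : F / 2 < v x₀ - φ x₀ :=
    (by linarith : F / 2 < v x - φ x).trans_le (hmax (ball_subset_closedBall hx))
  have hx₀b : x₀ ∈ ball (0 : Euc n) R := by
    rw [mem_ball]
    refine lt_of_le_of_ne hx₀ fun h => ?_
    linarith [hbdry x₀ h]
  have hv₀ : ContDiffAt ℝ 2 v x₀ := hv.contDiffAt (isOpen_ball.mem_nhds hx₀b)
  have hloc : IsLocalMax (v - φ) x₀ :=
    hmax.isLocalMax (Filter.mem_of_superset (isOpen_ball.mem_nhds hx₀b) ball_subset_closedBall)
  have hfd : fderiv ℝ (v - φ) =ᶠ[𝓝 x₀] fderiv ℝ v - fderiv ℝ φ := by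
    filter_upwards [hv₀.eventually (by simp)] with y hy
    exact fderiv_sub (hy.differentiableAt (by simp)) (hφ.differentiable (by simp) y)
  have hgrad : fderiv ℝ v x₀ = fderiv ℝ φ x₀ := by
    have := hfd.eq_of_nhds
    rw [hloc.fderiv_eq_zero] at this
    exact sub_eq_zero.mp this.symm
  have hhess : fderiv ℝ (fderiv ℝ (v - φ)) x₀ =
      fderiv ℝ (fderiv ℝ v) x₀ - fderiv ℝ (fderiv ℝ φ) x₀ := by
    rw [hfd.fderiv_eq]
    exact fderiv_sub ((hv₀.fderiv_right (m := 1) (by norm_num)).differentiableAt (by simp))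
      ((hφ.fderiv_right (m := 1) (by norm_num)).differentiable (by simp) x₀)
  have htrace := (hpos x₀ hx₀b).inv.posSemidef.sum_mul_bilin_nonpos
    (fderiv ℝ (fderiv ℝ (v - φ)) x₀)
    (hloc.fderiv_fderiv_nonpos (hv₀.sub hφ.contDiffAt)) fun i => EuclideanSpace.single i (1 : ℝ)
  simp only [hhess, _root_.sub_apply, mul_sub, Finset.sum_sub_distrib] at htrace
  have h1 := hsub x₀ hx₀b
  have h2 := hsuper x₀ hx₀b
  rw [hgrad] at h1
  have h3 := mul_nonpos_of_nonneg_of_nonpos (sq_nonneg ε) htrace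
  linarith

/-- maximum principle estimate of Bethuel–Brezis–Hélein type on the ball `B_R`. -/
theorem stmt17 (n : ℕ) (hn : 3 ≤ n) (R lam Lam : ℝ) (hR : 0 < R) (hlam : 0 < lam)
    (hLam : 0 < Lam) :
    ∃ ε₀ : ℝ, 0 < ε₀ ∧
      ∀ g : Euc n → Matrix (Fin n) (Fin n) ℝ,
        (∀ x ∈ ball (0 : Euc n) R, (g x).IsSymm ∧ (g x).PosDef) →
        g 0 = 1 →
        (∀ i j : Fin n, LipschitzOnWith (Real.toNNReal (Lam / R)) (fun x => g x i j)
          (ball (0 : Euc n) R)) →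
        (∀ x ∈ ball (0 : Euc n) R, ∀ ξ : Fin n → ℝ,
          lam * ∑ i, ξ i ^ 2 ≤ ∑ i, ∑ j, g x i j * ξ i * ξ j ∧
          ∑ i, ∑ j, g x i j * ξ i * ξ j ≤ lam⁻¹ * ∑ i, ξ i ^ 2) →
        ∀ (ε F A : ℝ) (v : Euc n → ℝ), 0 < ε → ε < ε₀ → 0 < F → 0 < A →
          ContDiffOn ℝ 2 v (ball (0 : Euc n) R) →
          ContinuousOn v (closedBall (0 : Euc n) R) →
          (∀ᵐ x ∂(volume.restrict (ball (0 : Euc n) R)),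
            -ε ^ 2 * laplacianG g v x + 2 * v x ≤ F) →
          (∀ x ∈ sphere (0 : Euc n) R, v x ≤ A) →
          ∀ x ∈ ball (0 : Euc n) R,
            v x ≤ F / 2 + A * Real.exp (Real.sqrt lam * (‖x‖ ^ 2 - R ^ 2) / (2 * ε * R)) := by
  obtain ⟨C, hC, hbounds⟩ := exists_coefficient_bounds n (r := Lam + 1) hlam
  set K := C * (n * (C * (Lam / R))) with hKdef
  have hK : 0 ≤ K := by positivity
  set D := Real.sqrt lam / R * (K * (n * R) + C) with hDdef
  have hD : 0 ≤ D := by positivity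
  refine ⟨1 / (D + 1), by positivity, ?_⟩
  intro g hg h0 hlip hell ε F A v hε hε₀ hF hA hv hvc hsub hbdry x hx
  have hpos (y) (hy : y ∈ ball (0 : Euc n) R) : (g y).PosDef := (hg y hy).2
  have hmem (y) (hy : y ∈ ball (0 : Euc n) R) :
      (fun i j => g y i j) ∈ coerciveSet n lam (Lam + 1) :=
    mem_coerciveSet_of_lipschitz hR hLam hpos h0 hlip (fun y hy ξ => (hell y hy ξ).1) hy
  have hεD : ε * D ≤ 1 := by
    have := (lt_div_iff₀ (by positivity)).mp hε₀
    linarith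
  set κ := Real.sqrt lam / (2 * ε * R) with hκdef
  have hκ : 0 ≤ κ := by positivity
  have hεκ : ε ^ 2 * (2 * κ * (K * (n * R) + C)) = ε * D := by
    rw [hκdef, hDdef]; field_simp
  have hεκ2 : ε ^ 2 * (4 * κ ^ 2 * (lam⁻¹ * R ^ 2)) = 1 := by
    rw [hκdef, div_pow, Real.sq_sqrt hlam.le]; field_simp; norm_num
  have key := le_barrier_of_nondivergence_ineq (R := R) (F := F) (ε := ε) hpos hv hvc
    (contDiff_expBarrier A κ (R ^ 2))
    (fun y hy => nondivergence_ineq hC (by positivity)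
      (fun m hm => ⟨(hbounds m hm).1, (hbounds m hm).2.2⟩) hpos hmem hlip hv hsub hy)
    (fun y hy => ?_) (fun y hy => ?_) hx
  · convert key using 4
    rw [hκdef]; ring
  · have hyR : ‖y‖ ≤ R := (mem_ball_zero_iff.mp hy).le
    have hP : 0 < A * Real.exp (κ * (‖y‖ ^ 2 - R ^ 2)) := by positivity
    have hgrad := sum_abs_fderiv_expBarrier_le hA.le hκ (R ^ 2) y
    have hquad : ∑ i, ∑ j, (g y)⁻¹ i j * (y i * y j) ≤ lam⁻¹ * R ^ 2 := by
      refine (sum_inv_mul_mul_le hlam (hpos y hy).det_pos.ne' (fun ξ => (hell y hy ξ).1)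
        fun i => y i).trans ?_
      rw [← EuclideanSpace.real_norm_sq_eq]
      gcongr
    have htr : ∑ i, (g y)⁻¹ i i ≤ C := (hbounds _ (hmem y hy)).2.1
    rw [sum_inv_mul_fderiv_fderiv_expBarrier]
    set P := A * Real.exp (κ * (‖y‖ ^ 2 - R ^ 2))
    calc _ ≤ ε ^ 2 * (K * (P * (2 * κ * (n * R))) +
          P * (4 * κ ^ 2 * (lam⁻¹ * R ^ 2) + 2 * κ * C)) := by
          gcongr
          exact hgrad.trans (by gcongr)
      _ = P * (ε ^ 2 * (2 * κ * (K * (n * R) + C)) +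
          ε ^ 2 * (4 * κ ^ 2 * (lam⁻¹ * R ^ 2))) := by ring
      _ ≤ 2 * P := by
          rw [hεκ, hεκ2]
          nlinarith
  · have hyR : ‖y‖ = R := mem_sphere_zero_iff_norm.mp hy
    simp only [hyR, sub_self, mul_zero, Real.exp_zero, mul_one]
    linarith [hbdry y hy]
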